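/- arXiv:1704.01639 — 3 statements merged into one kernel-verified Lean document; each statement's English description precedes it below -/
import Mathlib

section
/- Let A be a 2×2 matrix with integer entries such that (Ax)₀² − (Ax)₁² = x₀² − x₁² for all x ∈ ℤ², and such that A maps S₂ = ℕ × ℤ into S₂ (i.e., the first coordinate of Ax is nonnegative whenever x₀ ≥ 0). Then A is either the identity matrix or the matrix diag(1, −1) with rows (1,0) and (0,−1). -/
open Matrix

theorem stmt_3 (A : Matrix (Fin 2) (Fin 2) ℤ)
    (hA : ∀ x : Fin 2 → ℤ, (A.mulVec x 0) ^ 2 - (A.mulVec x 1) ^ 2 = (x 0) ^ 2 - (x 1) ^ 2)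
    (hS : ∀ x : Fin 2 → ℤ, 0 ≤ x 0 → 0 ≤ A.mulVec x 0) :
    A = 1 ∨ A = !![1, 0; 0, -1] := by
  have h10 := hA ![1, 0]
  have h01 := hA ![0, 1]
  have h11 := hA ![1, 1]
  have s10 := hS ![1, 0]
  have s01 := hS ![0, 1]
  have s01' := hS ![0, -1]
  simp only [Matrix.mulVec, dotProduct, Fin.sum_univ_two, Matrix.cons_val_zero,
    Matrix.cons_val_one] at h10 h01 h11 s10 s01 s01'
  have hb : A 0 1 = 0 := by linarith [s01 le_rfl, s01' le_rfl]
  have ha : 0 ≤ A 0 0 := by linarith [s10 zero_le_one]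
  rw [hb] at h01 h11
  have hd : A 1 1 ^ 2 = 1 := by linarith
  have hd' : A 1 1 = 1 ∨ A 1 1 = -1 := by simpa using hd
  have hc : A 1 0 = 0 := by
    rcases hd' with h | h <;> rw [h] at h11 <;> nlinarith
  rw [hc] at h10
  have ha' : A 0 0 = 1 := by nlinarith
  rcases hd' with h | h
  · left
    ext i j
    fin_cases i <;> fin_cases j <;> simp [ha', hb, hc, h]
  · right
    ext i j
    fin_cases i <;> fin_cases j <;> simp [ha', hb, hc, h]
end

section
/- Let A be a 4×4 matrix with integer entries such that ‖Ax‖₄² = ‖x‖₄² for all x ∈ ℤ⁴, and such that A maps S₄ = ℕ × ℤ³ into S₄ (i.e., the first coordinate of Ax is nonnegative whenever x₀ ≥ 0). Then A is the block-diagonal matrix 1 ⊕ B: its first row and first column are (1,0,0,0), and the remaining 3×3 block B is an integer orthogonal matrix (BᵀB = I). -/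
open Matrix

theorem stmt_4 (A : Matrix (Fin 4) (Fin 4) ℤ)
    (hA : ∀ x : Fin 4 → ℤ,
      (A.mulVec x 0) ^ 2 - (A.mulVec x 1) ^ 2 - (A.mulVec x 2) ^ 2 - (A.mulVec x 3) ^ 2
        = (x 0) ^ 2 - (x 1) ^ 2 - (x 2) ^ 2 - (x 3) ^ 2)
    (hS : ∀ x : Fin 4 → ℤ, 0 ≤ x 0 → 0 ≤ A.mulVec x 0) :
    A 0 0 = 1 ∧ (∀ i : Fin 3, A 0 i.succ = 0) ∧ (∀ i : Fin 3, A i.succ 0 = 0) ∧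
      (A.submatrix Fin.succ Fin.succ)ᵀ * (A.submatrix Fin.succ Fin.succ) = 1 := by
  have row_zero (i : Fin 3) : A 0 i.succ = 0 := by
    have h₁ := hS (Pi.single i.succ 1) (by simp)
    have h₂ := hS (-Pi.single i.succ 1) (by simp)
    simp only [mulVec_neg, mulVec_single_one, Pi.neg_apply, col_apply] at h₁ h₂
    lia
  have diag (i : Fin 4) := hA (Pi.single i 1)
  have polar (i j : Fin 4) := hA (Pi.single i 1 + Pi.single j 1)
  simp only [mulVec_add, mulVec_single_one, Pi.add_apply, col_apply] at diag polar
  have orth : (A.submatrix Fin.succ Fin.succ)ᵀ * (A.submatrix Fin.succ Fin.succ) = 1 := by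
    ext i j
    have hi := diag i.succ
    have hj := diag j.succ
    have hij := polar i.succ j.succ
    rw [row_zero] at hi hj hij
    rw [row_zero] at hij
    simp only [mul_apply, Fin.sum_univ_three, transpose_apply, submatrix_apply]
    fin_cases i <;> fin_cases j <;> simp at hi hj hij ⊢ <;> linarith
  have col_zero : (fun i : Fin 3 => A i.succ 0) = 0 := by
    have h : (A.submatrix Fin.succ Fin.succ)ᵀ *ᵥ (fun i : Fin 3 => A i.succ 0) = 0 := by
      ext i
      have h0 := diag 0
      have hi := diag i.succ
      have h0i := polar 0 i.succ
      rw [row_zero] at hi h0i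
      simp only [mulVec, dotProduct, Fin.sum_univ_three, transpose_apply, submatrix_apply]
      fin_cases i <;> simp at h0 hi h0i ⊢ <;> linarith
    rw [← one_mulVec (fun i : Fin 3 => A i.succ 0), ← mul_eq_one_comm.mp orth,
      ← mulVec_mulVec, h, mulVec_zero]
  refine ⟨?_, row_zero, congrFun col_zero, orth⟩
  have c₁ : A 1 0 = 0 := congrFun col_zero 0
  have c₂ : A 2 0 = 0 := congrFun col_zero 1
  have c₃ : A 3 0 = 0 := congrFun col_zero 2
  have h0 := diag 0
  have hpos := hS (Pi.single 0 1) (by simp)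
  simp only [mulVec_single_one, col_apply] at hpos
  simp [c₁, c₂, c₃] at h0
  lia
end

section
/- Let s and n be integers with 1 ≤ s ≤ n, and let v be a real number with 0 ≤ v < 1. Then n ≤ s/√(1 − v²) < n + 1 if and only if √(n² − s²)/n ≤ v < √((n+1)² − s²)/(n+1). -/
theorem le_div_sqrt_one_sub_sq_iff {m s v : ℝ} (hm : 0 < m) (hs : 0 ≤ s) (hv0 : 0 ≤ v)
    (hv1 : v < 1) :
    m ≤ s / Real.sqrt (1 - v ^ 2) ↔ Real.sqrt (m ^ 2 - s ^ 2) / m ≤ v := by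
  have hpos : 0 < 1 - v ^ 2 := by nlinarith
  rw [le_div_iff₀ (Real.sqrt_pos.2 hpos), div_le_iff₀ hm, Real.sqrt_le_left (by positivity),
    ← sq_le_sq₀ (by positivity) hs, mul_pow, Real.sq_sqrt hpos.le]
  constructor <;> intro h <;> linarith

theorem stmt_10 (s n : ℕ) (hs : 1 ≤ s) (hsn : s ≤ n) (v : ℝ) (hv0 : 0 ≤ v) (hv1 : v < 1) :
    ((n : ℝ) ≤ (s : ℝ) / Real.sqrt (1 - v ^ 2) ∧ (s : ℝ) / Real.sqrt (1 - v ^ 2) < (n : ℝ) + 1)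
      ↔ (Real.sqrt ((n : ℝ) ^ 2 - (s : ℝ) ^ 2) / (n : ℝ) ≤ v ∧
          v < Real.sqrt (((n : ℝ) + 1) ^ 2 - (s : ℝ) ^ 2) / ((n : ℝ) + 1)) := by
  have hn : (0 : ℝ) < n := by exact_mod_cast hs.trans hsn
  have hs0 : (0 : ℝ) ≤ s := s.cast_nonneg
  rw [le_div_sqrt_one_sub_sq_iff hn hs0 hv0 hv1, ← not_le,
    le_div_sqrt_one_sub_sq_iff (by positivity) hs0 hv0 hv1, not_le]
end
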